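/- If u₁ and u₂ are strong solutions of the equation ∂_t u = (1/2) u ∂_x² u on a common time interval [0,T̄) with the same initial data u₁(0,·) = u₂(0,·), then u₁ = u₂ on [0,T̄) × ℝ. -/

import Mathlib

open MeasureTheory Set Filter

noncomputable section

/-- Regularity requirements in the definition of a weak solution of
`∂ₜ u = (1/2) u ∂ₓ² u` on `[0,T) × ℝ`: continuity on `[0,T) × ℝ`, local Lipschitz
continuity of `u(t,·)`, and continuity of `t ↦ u(t,·)` into `W^{1,∞}_loc(ℝ)`. -/
def RegWeak (T : ℝ) (u : ℝ → ℝ → ℝ) : Prop :=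
  ContinuousOn (Function.uncurry u) (Ico 0 T ×ˢ (univ : Set ℝ)) ∧
  (∀ t ∈ Ico (0:ℝ) T, ∀ R : ℝ, 0 < R →
    ∃ L : NNReal, LipschitzOnWith L (u t) (Icc (-R) R)) ∧
  (∀ t₀ ∈ Ico (0:ℝ) T, ∀ R : ℝ, 0 < R →
    Tendsto (fun t => ⨆ x : Icc (-R) R,
        (|u t x.1 - u t₀ x.1| + |deriv (u t) x.1 - deriv (u t₀) x.1|))
      (nhdsWithin t₀ (Ico 0 T)) (nhds 0))

/-- The weak (integral) formulation of `∂ₜ u = (1/2) u ∂ₓ² u` on `[0,T) × ℝ`,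
tested against every `ψ ∈ C_c^∞([0,T) × ℝ)`. -/
def WeakForm (T : ℝ) (u : ℝ → ℝ → ℝ) : Prop :=
  ∀ ψ : ℝ → ℝ → ℝ,
    ContDiff ℝ (⊤ : ℕ∞) (Function.uncurry ψ) →
    HasCompactSupport (Function.uncurry ψ) →
    tsupport (Function.uncurry ψ) ⊆ Iio T ×ˢ (univ : Set ℝ) →
    (∫ x : ℝ, u 0 x * ψ 0 x) +
      (∫ t in Ico (0:ℝ) T, ∫ x : ℝ,
        (u t x * deriv (fun s => ψ s x) t
          - (1/2) * deriv (fun y => ψ t y * u t y) x * deriv (u t) x)) = 0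

/-- A weak solution of `∂ₜ u = (1/2) u ∂ₓ² u` on `[0,T) × ℝ`. -/
def IsWeakSolution (T : ℝ) (u : ℝ → ℝ → ℝ) : Prop :=
  (∀ t ∈ Ico (0:ℝ) T, ∀ x : ℝ, 0 ≤ u t x) ∧ RegWeak T u ∧ WeakForm T u

/-- `sup_{[0,T']×ℝ} ⟨x⟩⁻² u < ∞`, i.e. `u(t,x) ≤ M (x²+1)` on `[0,T'] × ℝ`. -/
def QuadBoundOn (u : ℝ → ℝ → ℝ) (T' : ℝ) : Prop :=
  ∃ M : ℝ, ∀ t ∈ Icc (0:ℝ) T', ∀ x : ℝ, u t x ≤ M * (x ^ 2 + 1)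

/-- For a.e. `t ∈ (0,T']` the function `u(t,·)` is twice differentiable, and
`t ↦ ess sup_x |∂ₓ² u(t,x)|` is integrable on `[0,T']` (expressed via an
integrable majorant `g`). -/
def SecondDerivIntegrableOn (u : ℝ → ℝ → ℝ) (T' : ℝ) : Prop :=
  ∃ g : ℝ → ℝ, IntegrableOn g (Icc (0:ℝ) T') ∧
    ∀ᵐ t ∂(volume.restrict (Ioc (0:ℝ) T')),
      (∀ x : ℝ, DifferentiableAt ℝ (u t) x ∧ DifferentiableAt ℝ (deriv (u t)) x) ∧
      (∀ x : ℝ, |deriv (deriv (u t)) x| ≤ g t)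

/-- A strong solution of `∂ₜ u = (1/2) u ∂ₓ² u` on `[0,T) × ℝ`. -/
def IsStrongSolution (T : ℝ) (u : ℝ → ℝ → ℝ) : Prop :=
  IsWeakSolution T u ∧
  ∀ T' : ℝ, 0 < T' → T' < T → QuadBoundOn u T' ∧ SecondDerivIntegrableOn u T'

lemma eventually_close_of_regWeak {T : ℝ} {u : ℝ → ℝ → ℝ} (h : RegWeak T u) {t₀ : ℝ}
    (ht₀ : t₀ ∈ Ico 0 T) {R ε : ℝ} (hR : 0 < R) (hε : 0 < ε) :
    ∀ᶠ t in nhdsWithin t₀ (Ico 0 T), ∀ x ∈ Icc (-R) R,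
      |u t x - u t₀ x| < ε ∧ |deriv (u t) x - deriv (u t₀) x| < ε := by
  obtain ⟨hc, hL, hW⟩ := h
  have hbdd : ∀ t ∈ Ico 0 T, BddAbove (range fun x : Icc (-R) R =>
      (|u t x.1 - u t₀ x.1| + |deriv (u t) x.1 - deriv (u t₀) x.1|)) := by
    intro t ht
    have hcont : ∀ s ∈ Ico 0 T, ContinuousOn (u s) (Icc (-R) R) := fun s hs => by
      obtain ⟨L, hL⟩ := hL s hs R hR
      exact hL.continuousOn
    have hder : ∀ s ∈ Ico 0 T, ∃ L : ℝ, ∀ x ∈ Icc (-R) R, |deriv (u s) x| ≤ L := by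
      intro s hs
      obtain ⟨L, hL⟩ := hL s hs (R + 1) (by linarith)
      refine ⟨L, fun x hx => norm_deriv_le_of_lipschitzOn (Icc_mem_nhds ?_ ?_) hL⟩
      · linarith [hx.1]
      · linarith [hx.2]
    obtain ⟨K, hK⟩ := isCompact_Icc.exists_bound_of_continuousOn
      ((hcont t ht).sub (hcont t₀ ht₀))
    obtain ⟨L₁, hL₁⟩ := hder t ht
    obtain ⟨L₂, hL₂⟩ := hder t₀ ht₀
    refine ⟨K + (L₁ + L₂), ?_⟩
    rintro _ ⟨x, rfl⟩
    have h1 : |u t x.1 - u t₀ x.1| ≤ K := hK x.1 x.2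
    have h2 := abs_sub (deriv (u t) x.1) (deriv (u t₀) x.1)
    have h3 := hL₁ x.1 x.2
    have h4 := hL₂ x.1 x.2
    show |u t x.1 - u t₀ x.1| + |deriv (u t) x.1 - deriv (u t₀) x.1| ≤ _
    linarith
  filter_upwards [(hW t₀ ht₀ R hR).eventually (gt_mem_nhds hε), self_mem_nhdsWithin]
    with t ht htI x hx
  have h1 := le_ciSup (hbdd t htI) ⟨x, hx⟩
  have h2 := lt_of_le_of_lt h1 ht
  simp only at h2
  exact ⟨by linarith [abs_nonneg (deriv (u t) x - deriv (u t₀) x)],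
    by linarith [abs_nonneg (u t x - u t₀ x)]⟩

lemma mem_closure_twice_differentiable {T : ℝ} {u : ℝ → ℝ → ℝ}
    (h : ∀ T' : ℝ, 0 < T' → T' < T → SecondDerivIntegrableOn u T') {t₀ : ℝ}
    (ht₀ : t₀ ∈ Ico 0 T) :
    t₀ ∈ closure {t | t ∈ Ico 0 T ∧
      ∀ x, DifferentiableAt ℝ (u t) x ∧ DifferentiableAt ℝ (deriv (u t)) x} := by
  rw [Metric.mem_closure_iff]
  intro ε hε
  obtain ⟨h1, h2⟩ := ht₀
  obtain ⟨g, -, hg⟩ := h ((t₀ + T) / 2) (by linarith) (by linarith)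
  set b := min (t₀ + ε) ((t₀ + T) / 2) with hb
  have hlt : t₀ < b := lt_min (by linarith) (by linarith)
  have hsub : Ioo t₀ b ⊆ Ioc 0 ((t₀ + T) / 2) := fun t ht =>
    ⟨by linarith [ht.1], ht.2.le.trans (min_le_right _ _)⟩
  have hae := ae_restrict_of_ae_restrict_of_subset hsub hg
  have hne : (volume.restrict (Ioo t₀ b)) univ ≠ 0 := by
    simp [Real.volume_Ioo, hlt]
  have hae' := hae.and (ae_restrict_mem (μ := volume) (measurableSet_Ioo (a := t₀) (b := b)))
  have : (ae (volume.restrict (Ioo t₀ b))).NeBot := by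
    rw [ae_neBot]
    intro h0
    exact hne (by simp [h0])
  obtain ⟨t, ⟨ht, -⟩, htm⟩ := hae'.exists
  refine ⟨t, ⟨⟨by linarith [htm.1], ?_⟩, ht⟩, ?_⟩
  · have := htm.2.trans_le (min_le_right (t₀ + ε) ((t₀ + T) / 2))
    linarith
  · have := htm.2.trans_le (min_le_left (t₀ + ε) ((t₀ + T) / 2))
    rw [Real.dist_eq, abs_lt]
    constructor <;> linarith [htm.1]

/-- At every time the spatial profile is `C¹`, as a locally `C¹`-limit of `C¹` profiles. -/
lemma IsStrongSolution.contDiff_profile {T : ℝ} {u : ℝ → ℝ → ℝ} (h : IsStrongSolution T u)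
    {t₀ : ℝ} (ht₀ : t₀ ∈ Ico 0 T) :
    (∀ x, HasDerivAt (u t₀) (deriv (u t₀) x) x) ∧ Continuous (deriv (u t₀)) := by
  set S := {t | t ∈ Ico 0 T ∧
      ∀ x, DifferentiableAt ℝ (u t) x ∧ DifferentiableAt ℝ (deriv (u t)) x} with hS
  have hcl : t₀ ∈ closure S :=
    mem_closure_twice_differentiable (fun T' h0 h1 => (h.2 T' h0 h1).2) ht₀
  have : (nhdsWithin t₀ S).NeBot := mem_closure_iff_nhdsWithin_neBot.1 hcl
  have hle : nhdsWithin t₀ S ≤ nhdsWithin t₀ (Ico 0 T) := nhdsWithin_mono _ fun t ht => ht.1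
  have hclose : ∀ R : ℝ, 0 < R → ∀ ε > 0, ∀ᶠ t in nhdsWithin t₀ S, ∀ x ∈ Ioo (-R) R,
      |u t x - u t₀ x| < ε ∧ |deriv (u t) x - deriv (u t₀) x| < ε := fun R hR ε hε =>
    (Filter.Eventually.filter_mono hle (eventually_close_of_regWeak h.1.2.1 ht₀ hR hε)).mono
      fun t ht x hx => ht x (Ioo_subset_Icc_self hx)
  have hunif : ∀ R : ℝ, 0 < R →
      TendstoUniformlyOn (fun t => deriv (u t)) (deriv (u t₀)) (nhdsWithin t₀ S)
        (Ioo (-R) R) := by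
    intro R hR
    rw [Metric.tendstoUniformlyOn_iff]
    intro ε hε
    filter_upwards [hclose R hR ε hε] with t ht x hx
    rw [dist_comm, Real.dist_eq]
    exact (ht x hx).2
  have hmem : ∀ᶠ t in nhdsWithin t₀ S, t ∈ S := self_mem_nhdsWithin
  have hx : ∀ x : ℝ, 0 < |x| + 1 ∧ x ∈ Ioo (-(|x| + 1)) (|x| + 1) := fun x =>
    ⟨by positivity, by linarith [neg_abs_le x], by linarith [le_abs_self x]⟩
  refine ⟨fun x => ?_, continuous_iff_continuousAt.2 fun x => ?_⟩
  · refine hasDerivAt_of_tendstoUniformlyOn isOpen_Ioo (hunif _ (hx x).1)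
      (hmem.mono fun t ht y _ => (ht.2 y).1.hasDerivAt) (fun y hy => ?_) (hx x).2
    rw [Metric.tendsto_nhds]
    intro ε hε
    filter_upwards [hclose _ (hx x).1 ε hε] with t ht
    exact (ht y hy).1
  · refine ((hunif _ (hx x).1).continuousOn (Eventually.frequently ?_)).continuousAt
      (isOpen_Ioo.mem_nhds (hx x).2)
    exact hmem.mono fun t ht y _ => (ht.2 y).2.continuousAt.continuousWithinAt

lemma IsStrongSolution.continuousOn_deriv {T : ℝ} {u : ℝ → ℝ → ℝ} (h : IsStrongSolution T u) :
    ContinuousOn (fun z : ℝ × ℝ => deriv (u z.1) z.2) (Ico 0 T ×ˢ univ) := by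
  rintro ⟨t₀, x₀⟩ ⟨ht₀, -⟩
  have hR : 0 < |x₀| + 1 := by positivity
  refine Metric.tendsto_nhds.2 fun ε hε => ?_
  have h1 := eventually_close_of_regWeak h.1.2.1 ht₀ hR (half_pos hε)
  have h2 : ∀ᶠ x in nhds x₀, |deriv (u t₀) x - deriv (u t₀) x₀| < ε / 2 ∧
      x ∈ Icc (-(|x₀| + 1)) (|x₀| + 1) := by
    refine Eventually.and ?_ (Icc_mem_nhds (by linarith [neg_abs_le x₀])
      (by linarith [le_abs_self x₀]))
    exact Metric.tendsto_nhds.1 (h.contDiff_profile ht₀).2.continuousAt _ (half_pos hε)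
  rw [nhdsWithin_prod_eq, nhdsWithin_univ]
  filter_upwards [h1.prod_mk h2] with z hz
  have h3 := (hz.1 z.2 hz.2.2).2
  have h4 := hz.2.1
  rw [Real.dist_eq]
  calc _ ≤ _ := abs_sub_le _ (deriv (u t₀) z.2) _
    _ < ε := by linarith

lemma IsStrongSolution.exists_extension {T T' : ℝ} {u : ℝ → ℝ → ℝ} (h : IsStrongSolution T u)
    (h0 : 0 < T') (hT : T' < T) :
    ∃ U P : ℝ → ℝ → ℝ, Continuous (Function.uncurry U) ∧ Continuous (Function.uncurry P) ∧
      (∀ t x, HasDerivAt (U t) (P t x) x) ∧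
      (∀ t ∈ Icc 0 T', U t = u t ∧ P t = deriv (u t)) ∧
      (∀ t, ∃ t' ∈ Icc 0 T', U t = u t') := by
  have hm : ∀ t, max 0 (min t T') ∈ Ico 0 T := fun t =>
    ⟨le_max_left _ _, max_lt (h0.trans hT) ((min_le_right _ _).trans_lt hT)⟩
  have hc : Continuous fun z : ℝ × ℝ => (max 0 (min z.1 T'), z.2) := by fun_prop
  refine ⟨fun t => u (max 0 (min t T')), fun t => deriv (u (max 0 (min t T'))), ?_, ?_,
    fun t x => (h.contDiff_profile (hm t)).1 x, fun t ht => ?_,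
    fun t => ⟨_, ⟨le_max_left _ _, max_le h0.le (min_le_right _ _)⟩, rfl⟩⟩
  · exact h.1.2.1.1.comp_continuous hc fun z => ⟨hm _, mem_univ _⟩
  · exact h.continuousOn_deriv.comp_continuous hc fun z => ⟨hm _, mem_univ _⟩
  · simp [ht.1, ht.2]

lemma eq_sub_integral_of_forall_test {A B : ℝ → ℝ} (hA : Continuous A) (hB : Continuous B)
    {b : ℝ} (hb : 0 < b)
    (h : ∀ θ : ℝ → ℝ, ContDiff ℝ (⊤ : ℕ∞) θ → (∀ t, t ≤ -1 → θ t = 0) →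
      (∀ t, b ≤ t → θ t = 0) →
      A 0 * θ 0 + ∫ t in (0:ℝ)..b, (A t * deriv θ t - B t * θ t) = 0) :
    ∀ t ∈ Icc 0 b, A t = A 0 - ∫ s in (0:ℝ)..t, B s := by
  set D : ℝ → ℝ := fun t => ∫ s in (0:ℝ)..t, B s with hD
  have hD' : ∀ t, HasDerivAt D (B t) t := fun t => (hB.integral_hasStrictDerivAt 0 t).hasDerivAt
  have hDc : Continuous D := continuous_iff_continuousAt.2 fun t => (hD' t).continuousAt
  set C : ℝ → ℝ := fun t => A t - A 0 + D t with hC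
  have hCc : Continuous C := by fun_prop
  have key : ∀ f : ℝ → ℝ, ContDiff ℝ (⊤ : ℕ∞) f → HasCompactSupport f → tsupport f ⊆ Ioo 0 b →
      ∫ t, f t • C t = 0 := by
    intro f hf _ hfs
    have hf0 : ∀ t, t ∉ Ioo 0 b → f t = 0 := fun t ht => by
      by_contra hne
      exact ht (hfs (subset_tsupport f hne))
    set F : ℝ → ℝ := fun t => ∫ s in b..t, f s with hF
    have hF' : ∀ t, HasDerivAt F (f t) t :=
      fun t => (hf.continuous.integral_hasStrictDerivAt b t).hasDerivAt
    have hFs : ContDiff ℝ (⊤ : ℕ∞) F := by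
      rw [contDiff_infty_iff_deriv]
      refine ⟨fun t => (hF' t).differentiableAt, ?_⟩
      rwa [show deriv F = f from funext fun t => (hF' t).deriv]
    have hFb : ∀ t, b ≤ t → F t = 0 := by
      intro t ht
      refine (intervalIntegral.integral_congr (g := fun _ => (0:ℝ)) fun s hs => ?_).trans (by simp)
      rw [uIcc_of_le ht] at hs
      exact hf0 s fun hs' => absurd hs'.2 (not_lt.2 hs.1)
    set θ : ℝ → ℝ := fun t => Real.smoothTransition (t + 1) * F t with hθ
    have hst : ∀ t : ℝ, 0 ≤ t → θ t = F t := fun t ht => by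
      simp [hθ, Real.smoothTransition.one_of_one_le (by linarith : (1:ℝ) ≤ t + 1)]
    have hderiv : ∀ t ∈ Ioo 0 b, deriv θ t = f t := by
      intro t ht
      have : θ =ᶠ[nhds t] F := by
        filter_upwards [lt_mem_nhds ht.1] with s hs using hst s hs.le
      rw [this.deriv_eq, (hF' t).deriv]
    have h1 := h θ
      ((Real.smoothTransition.contDiff.comp (contDiff_id.add contDiff_const)).mul hFs)
      (fun t ht => by simp [hθ, Real.smoothTransition.zero_of_nonpos (by linarith : t + 1 ≤ 0)])
      (fun t ht => by simp [hθ, hFb t ht])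
    have h2 : ∫ t in (0:ℝ)..b, (A t * deriv θ t - B t * θ t) =
        ∫ t in (0:ℝ)..b, (A t * f t - B t * F t) := by
      rw [intervalIntegral.integral_of_le hb.le, intervalIntegral.integral_of_le hb.le,
        integral_Ioc_eq_integral_Ioo, integral_Ioc_eq_integral_Ioo]
      refine setIntegral_congr_fun measurableSet_Ioo fun t ht => ?_
      simp only [hderiv t ht, hst t ht.1.le]
    have hFc : Continuous F := hFs.continuous
    have hfc : Continuous f := hf.continuous
    have h3 : ∫ t in (0:ℝ)..b, (f t * (D t - A 0) + F t * B t) =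
        F b * (D b - A 0) - F 0 * (D 0 - A 0) :=
      intervalIntegral.integral_eq_sub_of_hasDerivAt
        (f := fun t => F t * (D t - A 0))
        (fun t _ => (hF' t).mul ((hD' t).sub_const (A 0)))
        (Continuous.intervalIntegrable (by fun_prop) _ _)
    have hD0 : D 0 = 0 := by simp [hD]
    rw [hFb b le_rfl, hD0] at h3
    rw [hst 0 le_rfl, h2] at h1
    have h4 : ∫ t, f t • C t = ∫ t in (0:ℝ)..b, f t * C t := by
      rw [intervalIntegral.integral_of_le hb.le,
        setIntegral_eq_integral_of_forall_compl_eq_zero]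
      · simp
      · intro t ht
        rw [hf0 t fun h => ht (Ioo_subset_Ioc_self h), zero_mul]
    have h5 : ∫ t in (0:ℝ)..b, f t * C t = (∫ t in (0:ℝ)..b, (A t * f t - B t * F t)) +
        ∫ t in (0:ℝ)..b, (f t * (D t - A 0) + F t * B t) := by
      rw [← intervalIntegral.integral_add (Continuous.intervalIntegrable (by fun_prop) _ _)
        (Continuous.intervalIntegrable (by fun_prop) _ _)]
      refine intervalIntegral.integral_congr fun t _ => ?_
      simp only [hC]
      ring
    rw [h4, h5, h3]
    linarith
  have hae := isOpen_Ioo.ae_eq_zero_of_integral_contDiff_smul_eq_zero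
    (hCc.locallyIntegrable.locallyIntegrableOn _) key
  have heq : EqOn C (fun _ => 0) (Icc 0 b) := by
    refine Measure.eqOn_Icc_of_ae_eq volume hb.ne ?_ hCc.continuousOn continuousOn_const
    rw [← restrict_Ioo_eq_restrict_Icc]
    exact (ae_restrict_iff' measurableSet_Ioo).2 hae
  intro t ht
  have := heq ht
  simp only [hC] at this
  linarith

lemma integral_eq_intervalIntegral_of_eq_zero {f : ℝ → ℝ} {R : ℝ} (hR : 0 ≤ R)
    (hf : ∀ x, R < |x| → f x = 0) : ∫ x, f x = ∫ x in (-R)..R, f x := by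
  rw [intervalIntegral.integral_of_le (by linarith), ← integral_Icc_eq_integral_Ioc,
    setIntegral_eq_integral_of_forall_compl_eq_zero]
  intro x hx
  refine hf x (not_le.1 fun h => hx (abs_le.1 h))

lemma deriv_eq_zero_of_forall_abs_gt {η : ℝ → ℝ} {R : ℝ} (h : ∀ x, R ≤ |x| → η x = 0) {x : ℝ}
    (hx : R < |x|) : deriv η x = 0 := by
  have : η =ᶠ[nhds x] fun _ => 0 := by
    filter_upwards [continuous_abs.continuousAt.eventually (lt_mem_nhds hx)] with y hy
      using h y hy.le
  rw [this.deriv_eq, deriv_const]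

lemma IsStrongSolution.weak_identity_smooth {T T' : ℝ} {u U P : ℝ → ℝ → ℝ}
    (h : IsStrongSolution T u) (h0 : 0 < T') (hT : T' < T)
    (hU : Continuous (Function.uncurry U)) (hP : Continuous (Function.uncurry P))
    (hUP : ∀ t x, HasDerivAt (U t) (P t x) x)
    (hu : ∀ t ∈ Icc 0 T', U t = u t ∧ P t = deriv (u t))
    {η : ℝ → ℝ} (hη : ContDiff ℝ (⊤ : ℕ∞) η) {R : ℝ} (hR : 0 < R)
    (hηR : ∀ x, R ≤ |x| → η x = 0) {t : ℝ} (ht : t ∈ Icc 0 T') :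
    ∫ x in (-R)..R, U t x * η x = (∫ x in (-R)..R, U 0 x * η x) -
      ∫ s in (0:ℝ)..t, ∫ x in (-R)..R,
        (1/2) * (deriv η x * (U s x * P s x) + η x * (P s x) ^ 2) := by
  have hηc : Continuous η := hη.continuous
  have hη'c : Continuous (deriv η) := hη.continuous_deriv (by simp)
  have hηd : ∀ x, HasDerivAt η (deriv η x) x := fun x =>
    (hη.differentiable (by simp) x).hasDerivAt
  have hη'R : ∀ x, R < |x| → deriv η x = 0 := fun x => deriv_eq_zero_of_forall_abs_gt hηR
  refine eq_sub_integral_of_forall_test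
    (A := fun t => ∫ x in (-R)..R, U t x * η x)
    (B := fun s => ∫ x in (-R)..R,
        (1/2) * (deriv η x * (U s x * P s x) + η x * (P s x) ^ 2)) ?_ ?_ h0 ?_ t ht
  · exact intervalIntegral.continuous_parametric_intervalIntegral_of_continuous'
      (by fun_prop) _ _
  · exact intervalIntegral.continuous_parametric_intervalIntegral_of_continuous'
      (by fun_prop) _ _
  intro θ hθ hθ1 hθ2
  have hθ2' : ∀ t, T' < t → deriv θ t = 0 := by
    intro t ht
    have : θ =ᶠ[nhds t] fun _ => 0 := by
      filter_upwards [lt_mem_nhds ht] with s hs using hθ2 s hs.le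
    rw [this.deriv_eq, deriv_const]
  have hd1 : ∀ t x, deriv (fun s => θ s * η x) t = deriv θ t * η x := fun t x =>
    ((hθ.differentiable (by simp) t).hasDerivAt.mul_const _).deriv
  have hd2 : ∀ t x, deriv (fun y => θ t * η y * U t y) x =
      θ t * deriv η x * U t x + θ t * η x * P t x := fun t x =>
    (((hηd x).const_mul (θ t)).mul (hUP t x)).deriv
  have hsupp : Function.support (Function.uncurry fun t x => θ t * η x) ⊆
      Icc (-1) T' ×ˢ Icc (-R) R := by
    rintro ⟨t, x⟩ hne
    have hne' : θ t * η x ≠ 0 := hne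
    refine ⟨⟨?_, ?_⟩, abs_le.1 ?_⟩
    · by_contra hlt
      exact left_ne_zero_of_mul hne' (hθ1 t (not_le.1 hlt).le)
    · by_contra hlt
      exact left_ne_zero_of_mul hne' (hθ2 t (not_le.1 hlt).le)
    · by_contra hlt
      exact right_ne_zero_of_mul hne' (hηR x (not_le.1 hlt).le)
  have htsupp := closure_minimal hsupp (isClosed_Icc.prod isClosed_Icc)
  have hweak := h.1.2.2 (fun t x => θ t * η x)
    ((hθ.comp contDiff_fst).mul (hη.comp contDiff_snd))
    ((isCompact_Icc.prod isCompact_Icc).of_isClosed_subset isClosed_closure htsupp)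
    (htsupp.trans fun z hz => ⟨hz.1.2.trans_lt hT, mem_univ _⟩)
  refine Eq.trans ?_ hweak
  congr 1
  · rw [integral_eq_intervalIntegral_of_eq_zero hR.le fun x hx => by rw [hηR x hx.le]; simp,
      ← intervalIntegral.integral_mul_const]
    refine intervalIntegral.integral_congr fun x _ => ?_
    simp only [(hu 0 ⟨le_rfl, h0.le⟩).1]
    ring
  · rw [intervalIntegral.integral_of_le h0.le, ← integral_Icc_eq_integral_Ioc]
    have hsub : Icc 0 T' ⊆ Ico 0 T := fun t ht => ⟨ht.1, ht.2.trans_lt hT⟩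
    rw [setIntegral_eq_of_subset_of_forall_sdiff_eq_zero measurableSet_Ico hsub]
    · refine setIntegral_congr_fun measurableSet_Icc fun t ht => ?_
      obtain ⟨e1, e2⟩ := hu t ht
      rw [integral_eq_intervalIntegral_of_eq_zero hR.le, ← intervalIntegral.integral_mul_const,
        ← intervalIntegral.integral_mul_const, ← intervalIntegral.integral_sub]
      · refine intervalIntegral.integral_congr fun x _ => ?_
        simp only [← e1, hd1, hd2, (hUP t x).deriv]
        ring
      · exact Continuous.intervalIntegrable (by fun_prop) _ _
      · exact Continuous.intervalIntegrable (by fun_prop) _ _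
      · intro x hx
        rw [← e1, hd1, hd2, hηR x hx.le, hη'R x hx]
        simp
    · intro t ht
      have hlt : T' < t := not_le.1 fun hle => ht.2 ⟨ht.1.1, hle⟩
      have hz : ∀ x, u t x * deriv (fun s => θ s * η x) t
          - (1/2) * deriv (fun y => θ t * η y * u t y) x * deriv (u t) x = 0 := by
        intro x
        rw [hd1, hθ2' t hlt, hθ2 t hlt.le]
        simp
      simp only [hz, integral_zero]

lemma exists_smooth_approx {η η' : ℝ → ℝ} (hη'c : Continuous η')
    (hη : ∀ x, HasDerivAt η (η' x) x) {R : ℝ} (hR : ∀ x, R ≤ |x| + 1 → η x = 0)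
    {ε : ℝ} (hε : 0 < ε) :
    ∃ ζ : ℝ → ℝ, ContDiff ℝ (⊤ : ℕ∞) ζ ∧ (∀ x, R ≤ |x| → ζ x = 0) ∧
      ∀ x, |η x - ζ x| ≤ ε ∧ |η' x - deriv ζ x| ≤ ε := by
  have hηc : Continuous η := continuous_iff_continuousAt.2 fun x => (hη x).continuousAt
  have hderiv : deriv η = η' := funext fun x => (hη x).deriv
  have hcd : ContDiff ℝ 1 η := by
    rw [contDiff_one_iff_deriv]
    exact ⟨fun x => (hη x).differentiableAt, by rwa [hderiv]⟩
  have hsupp : HasCompactSupport η := by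
    refine HasCompactSupport.intro (isCompact_Icc (a := -R) (b := R)) fun x hx => hR x ?_
    have : R < |x| := not_le.1 fun h => hx (abs_le.1 h)
    linarith
  have hsupp' : HasCompactSupport η' := hderiv ▸ hsupp.deriv
  have hu := Metric.uniformContinuous_iff.1 (hsupp.uniformContinuous_of_continuous hηc) ε hε
  have hu' := Metric.uniformContinuous_iff.1 (hsupp'.uniformContinuous_of_continuous hη'c) ε hε
  obtain ⟨δ₁, hδ₁, h1⟩ := hu
  obtain ⟨δ₂, hδ₂, h2⟩ := hu'
  set δ := min (min δ₁ δ₂) 1 with hδ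
  have hδ0 : 0 < δ := lt_min (lt_min hδ₁ hδ₂) one_pos
  let k : ContDiffBump (0 : ℝ) := ⟨δ / 2, δ, half_pos hδ0, half_lt_self hδ0⟩
  have hk : ∀ x y : ℝ, y ∈ Metric.ball x k.rOut → dist y x < δ₁ ∧ dist y x < δ₂ ∧ dist y x < 1 := by
    intro x y hy
    have hlt : dist y x < min (min δ₁ δ₂) 1 := hy
    simp only [lt_min_iff] at hlt
    exact ⟨hlt.1.1, hlt.1.2, hlt.2⟩
  have hder : ∀ x, HasDerivAt
      (convolution (k.normed volume) η (ContinuousLinearMap.lsmul ℝ ℝ) volume)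
      (convolution (k.normed volume) η' (ContinuousLinearMap.lsmul ℝ ℝ) volume x) x := by
    intro x
    rw [← hderiv]
    exact hsupp.hasDerivAt_convolution_right _ k.continuous_normed.locallyIntegrable hcd x
  refine ⟨convolution (k.normed volume) η (ContinuousLinearMap.lsmul ℝ ℝ) volume, ?_, ?_, ?_⟩
  · exact k.hasCompactSupport_normed.contDiff_convolution_left _ k.contDiff_normed
      hηc.locallyIntegrable
  · intro x hx
    have h3 : η x = 0 := hR x (by linarith)
    have h4 := k.dist_normed_convolution_le (μ := volume) (g := η) (x₀ := x) (ε := 0)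
      hηc.aestronglyMeasurable (fun y hy => by
        have h5 := (hk x y hy).2.2
        rw [Real.dist_eq] at h5
        have h6 : |x| - |y| ≤ |y - x| := by
          rw [abs_sub_comm]; exact abs_sub_abs_le_abs_sub x y
        rw [h3, hR y (by linarith), dist_self])
    rw [h3] at h4
    simpa using h4
  · intro x
    rw [(hder x).deriv, abs_sub_comm, abs_sub_comm (η' x)]
    exact ⟨k.dist_normed_convolution_le hηc.aestronglyMeasurable
        fun y hy => (h1 (hk x y hy).1).le,
      k.dist_normed_convolution_le hη'c.aestronglyMeasurable
        fun y hy => (h2 (hk x y hy).2.1).le⟩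

lemma eq_zero_of_forall_abs_le_mul {d K : ℝ} (hK : 0 ≤ K) (h : ∀ ε > 0, |d| ≤ ε * K) : d = 0 := by
  by_contra hd
  have hd' : 0 < |d| := abs_pos.2 hd
  have h1 := h (|d| / (K + 1)) (by positivity)
  rw [div_mul_eq_mul_div, le_div_iff₀ (by positivity)] at h1
  nlinarith

lemma weak_identity_of_smooth {U P : ℝ → ℝ → ℝ}
    (hU : Continuous (Function.uncurry U)) (hP : Continuous (Function.uncurry P))
    {t R : ℝ} (ht : 0 ≤ t) (hR : 0 < R)
    (h : ∀ ζ : ℝ → ℝ, ContDiff ℝ (⊤ : ℕ∞) ζ → (∀ x, R ≤ |x| → ζ x = 0) →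
      ∫ x in (-R)..R, U t x * ζ x = (∫ x in (-R)..R, U 0 x * ζ x) -
        ∫ s in (0:ℝ)..t, ∫ x in (-R)..R,
          (1/2) * (deriv ζ x * (U s x * P s x) + ζ x * (P s x) ^ 2))
    {η η' : ℝ → ℝ} (hη'c : Continuous η') (hη : ∀ x, HasDerivAt η (η' x) x)
    (hηR : ∀ x, R ≤ |x| + 1 → η x = 0) :
    ∫ x in (-R)..R, U t x * η x = (∫ x in (-R)..R, U 0 x * η x) -
      ∫ s in (0:ℝ)..t, ∫ x in (-R)..R,
        (1/2) * (η' x * (U s x * P s x) + η x * (P s x) ^ 2) := by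
  have hηc : Continuous η := continuous_iff_continuousAt.2 fun x => (hη x).continuousAt
  obtain ⟨C₁, hC₁⟩ := ((isCompact_Icc (a := (0:ℝ)) (b := t)).prod
    (isCompact_Icc (a := -R) (b := R))).exists_bound_of_continuousOn hU.continuousOn
  obtain ⟨C₂, hC₂⟩ := ((isCompact_Icc (a := (0:ℝ)) (b := t)).prod
    (isCompact_Icc (a := -R) (b := R))).exists_bound_of_continuousOn hP.continuousOn
  have hUb : ∀ s ∈ Icc 0 t, ∀ x ∈ Icc (-R) R, |U s x| ≤ C₁ := fun s hs x hx =>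
    hC₁ (s, x) ⟨hs, hx⟩
  have hPb : ∀ s ∈ Icc 0 t, ∀ x ∈ Icc (-R) R, |P s x| ≤ C₂ := fun s hs x hx =>
    hC₂ (s, x) ⟨hs, hx⟩
  have hC₁0 : 0 ≤ C₁ := (abs_nonneg _).trans (hUb 0 ⟨le_rfl, ht⟩ 0 (by constructor <;> linarith))
  have hC₂0 : 0 ≤ C₂ := (abs_nonneg _).trans (hPb 0 ⟨le_rfl, ht⟩ 0 (by constructor <;> linarith))
  have hIoc : ∀ x ∈ uIoc (-R) R, x ∈ Icc (-R) R := fun x hx => by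
    rw [uIoc_of_le (by linarith)] at hx
    exact Ioc_subset_Icc_self hx
  have hlen : |R - -R| = 2 * R := by rw [abs_of_nonneg] <;> linarith
  rw [← sub_eq_zero]
  refine eq_zero_of_forall_abs_le_mul
    (K := C₁ * (2 * R) + C₁ * (2 * R) + ((1/2) * (C₁ * C₂ + C₂ ^ 2) * (2 * R)) * t)
    (by positivity) fun ε hε => ?_
  obtain ⟨ζ, hζ, hζR, hζε⟩ := exists_smooth_approx hη'c hη hηR hε
  have hζc : Continuous ζ := hζ.continuous
  have hζ'c : Continuous (deriv ζ) := hζ.continuous_deriv (by simp)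
  have hlin : ∀ s ∈ Icc 0 t,
      |(∫ x in (-R)..R, U s x * η x) - ∫ x in (-R)..R, U s x * ζ x| ≤ C₁ * ε * (2 * R) := by
    intro s hs
    rw [← intervalIntegral.integral_sub (Continuous.intervalIntegrable (by fun_prop) _ _)
      (Continuous.intervalIntegrable (by fun_prop) _ _), ← hlen, ← Real.norm_eq_abs]
    refine intervalIntegral.norm_integral_le_of_norm_le_const fun x hx => ?_
    rw [← mul_sub, Real.norm_eq_abs, abs_mul]
    exact mul_le_mul (hUb s hs x (hIoc x hx)) (hζε x).1 (abs_nonneg _) hC₁0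
  have hquad : ∀ s ∈ Icc 0 t,
      |(∫ x in (-R)..R, (1/2) * (η' x * (U s x * P s x) + η x * (P s x) ^ 2)) -
        ∫ x in (-R)..R, (1/2) * (deriv ζ x * (U s x * P s x) + ζ x * (P s x) ^ 2)| ≤
      (1/2) * (ε * (C₁ * C₂) + ε * C₂ ^ 2) * (2 * R) := by
    intro s hs
    rw [← intervalIntegral.integral_sub (Continuous.intervalIntegrable (by fun_prop) _ _)
      (Continuous.intervalIntegrable (by fun_prop) _ _), ← hlen, ← Real.norm_eq_abs]
    refine intervalIntegral.norm_integral_le_of_norm_le_const fun x hx => ?_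
    have e : (1/2) * (η' x * (U s x * P s x) + η x * (P s x) ^ 2) -
        (1/2) * (deriv ζ x * (U s x * P s x) + ζ x * (P s x) ^ 2) =
        (1/2) * ((η' x - deriv ζ x) * (U s x * P s x) + (η x - ζ x) * (P s x) ^ 2) := by ring
    have h1 := hUb s hs x (hIoc x hx)
    have h2 := hPb s hs x (hIoc x hx)
    rw [e, Real.norm_eq_abs, abs_mul, abs_of_pos (by norm_num : (0:ℝ) < 1/2)]
    refine mul_le_mul_of_nonneg_left ((abs_add_le _ _).trans (add_le_add ?_ ?_)) (by norm_num)
    · rw [abs_mul, abs_mul]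
      exact mul_le_mul (hζε x).2 (mul_le_mul h1 h2 (abs_nonneg _) hC₁0) (by positivity) hε.le
    · rw [abs_mul, abs_pow]
      exact mul_le_mul (hζε x).1 (pow_le_pow_left₀ (abs_nonneg _) h2 2) (by positivity) hε.le
  have hdouble : |(∫ s in (0:ℝ)..t, ∫ x in (-R)..R,
        (1/2) * (η' x * (U s x * P s x) + η x * (P s x) ^ 2)) -
      ∫ s in (0:ℝ)..t, ∫ x in (-R)..R,
        (1/2) * (deriv ζ x * (U s x * P s x) + ζ x * (P s x) ^ 2)| ≤
      (1/2) * (ε * (C₁ * C₂) + ε * C₂ ^ 2) * (2 * R) * t := by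
    have hc1 : Continuous fun s => ∫ x in (-R)..R,
        (1/2) * (η' x * (U s x * P s x) + η x * (P s x) ^ 2) :=
      intervalIntegral.continuous_parametric_intervalIntegral_of_continuous' (by fun_prop) _ _
    have hc2 : Continuous fun s => ∫ x in (-R)..R,
        (1/2) * (deriv ζ x * (U s x * P s x) + ζ x * (P s x) ^ 2) :=
      intervalIntegral.continuous_parametric_intervalIntegral_of_continuous' (by fun_prop) _ _
    rw [← intervalIntegral.integral_sub (hc1.intervalIntegrable _ _) (hc2.intervalIntegrable _ _)]
    have htt : |t - 0| = t := by rw [sub_zero, abs_of_nonneg ht]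
    conv_rhs => rw [← htt]
    rw [← Real.norm_eq_abs]
    refine intervalIntegral.norm_integral_le_of_norm_le_const fun s hs => ?_
    rw [uIoc_of_le ht] at hs
    exact hquad s (Ioc_subset_Icc_self hs)
  have hz := h ζ hζ hζR
  have ht1 := abs_le.1 (hlin t ⟨ht, le_rfl⟩)
  have ht2 := abs_le.1 (hlin 0 ⟨le_rfl, ht⟩)
  have ht3 := abs_le.1 hdouble
  rw [abs_le]
  constructor <;> linarith [ht1.1, ht1.2, ht2.1, ht2.2, ht3.1, ht3.2]

lemma hasDerivAt_integral_sq_mul {w p Q k : ℝ → ℝ → ℝ} {φ φ' : ℝ → ℝ} {b R : ℝ}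
    (hw : Continuous (Function.uncurry w)) (hp : Continuous (Function.uncurry p))
    (hQ : Continuous (Function.uncurry Q)) (hk : Continuous (Function.uncurry k))
    (hwp : ∀ t x, HasDerivAt (w t) (p t x) x)
    (hφ' : Continuous φ') (hφ : ∀ x, HasDerivAt φ (φ' x) x) (hφR : ∀ x, R ≤ |x| + 1 → φ x = 0)
    (h : ∀ η η' : ℝ → ℝ, Continuous η' → (∀ x, HasDerivAt η (η' x) x) →
      (∀ x, R ≤ |x| + 1 → η x = 0) → ∀ s ∈ Icc 0 b, ∀ t ∈ Icc 0 b,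
      (∫ x in (-R)..R, w t x * η x) - (∫ x in (-R)..R, w s x * η x) =
        -∫ r in s..t, ∫ x in (-R)..R, (η' x * Q r x + η x * k r x))
    {t : ℝ} (ht : t ∈ Ioo 0 b) :
    HasDerivAt (fun t => ∫ x in (-R)..R, w t x ^ 2 * φ x)
      (-2 * ∫ x in (-R)..R, ((p t x * φ x + w t x * φ' x) * Q t x + w t x * φ x * k t x)) t := by
  have hφc : Continuous φ := continuous_iff_continuousAt.2 fun x => (hφ x).continuousAt
  set G : ℝ → ℝ → ℝ := fun a r =>
    ∫ x in (-R)..R, ((p a x * φ x + w a x * φ' x) * Q r x + w a x * φ x * k r x) with hG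
  have hGc : Continuous fun z : ℝ × ℝ => G z.1 z.2 :=
    intervalIntegral.continuous_parametric_intervalIntegral_of_continuous'
      (f := fun (z : ℝ × ℝ) x => (p z.1 x * φ x + w z.1 x * φ' x) * Q z.2 x
        + w z.1 x * φ x * k z.2 x) (by fun_prop) _ _
  have hid : ∀ a, ∀ s ∈ Icc 0 b, (∫ x in (-R)..R, w s x * (w a x * φ x)) -
      (∫ x in (-R)..R, w t x * (w a x * φ x)) = -∫ r in t..s, G a r := fun a s hs =>
    h (fun x => w a x * φ x) (fun x => p a x * φ x + w a x * φ' x) (by fun_prop)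
      (fun x => (hwp a x).mul (hφ x)) (fun x hx => by simp [hφR x hx])
      t (Ioo_subset_Icc_self ht) s hs
  have hinc : ∀ s ∈ Icc 0 b, (∫ x in (-R)..R, w s x ^ 2 * φ x) -
      (∫ x in (-R)..R, w t x ^ 2 * φ x) = -∫ r in t..s, (G s r + G t r) := by
    intro s hs
    rw [intervalIntegral.integral_add (Continuous.intervalIntegrable (by fun_prop) _ _)
      (Continuous.intervalIntegrable (by fun_prop) _ _), neg_add, ← hid s s hs, ← hid t s hs]
    have e1 : ∫ x in (-R)..R, w s x ^ 2 * φ x = ∫ x in (-R)..R, w s x * (w s x * φ x) :=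
      intervalIntegral.integral_congr fun x _ => by ring
    have e2 : ∫ x in (-R)..R, w t x ^ 2 * φ x = ∫ x in (-R)..R, w t x * (w t x * φ x) :=
      intervalIntegral.integral_congr fun x _ => by ring
    have e3 : ∫ x in (-R)..R, w t x * (w s x * φ x) = ∫ x in (-R)..R, w s x * (w t x * φ x) :=
      intervalIntegral.integral_congr fun x _ => by ring
    rw [e1, e2, e3]
    ring
  rw [hasDerivAt_iff_isLittleO, Asymptotics.isLittleO_iff]
  intro c hc
  obtain ⟨δ, hδ, hδG⟩ := Metric.continuous_iff.1 hGc (t, t) (c / 2) (half_pos hc)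
  filter_upwards [Ioo_mem_nhds ht.1 ht.2, Metric.ball_mem_nhds t hδ] with s hs hsδ
  rw [hinc s (Ioo_subset_Icc_self hs)]
  have hconst : (s - t) • (-2 * G t t) = -∫ r in t..s, 2 * G t t := by
    simp only [intervalIntegral.integral_const, smul_eq_mul]
    ring
  change ‖_ - (s - t) • (-2 * G t t)‖ ≤ _
  rw [hconst, ← neg_sub', norm_neg,
    ← intervalIntegral.integral_sub (Continuous.intervalIntegrable (by fun_prop) _ _)
      (Continuous.intervalIntegrable (by fun_prop) _ _)]
  refine intervalIntegral.norm_integral_le_of_norm_le_const fun r hr => ?_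
  have hrt : dist r t < δ := by
    refine lt_of_le_of_lt ?_ (Metric.mem_ball.1 hsδ)
    rw [Real.dist_eq, Real.dist_eq]
    exact abs_sub_left_of_mem_uIcc (uIoc_subset_uIcc hr)
  have h1 := hδG (s, r) (by rw [Prod.dist_eq]; exact max_lt hsδ hrt)
  have h2 := hδG (t, r) (by rw [Prod.dist_eq]; exact max_lt (by simpa using hδ) hrt)
  rw [Real.dist_eq, abs_lt] at h1 h2
  simp only at h1 h2
  rw [Real.norm_eq_abs, abs_le]
  constructor <;> linarith [h1.1, h1.2, h2.1, h2.2]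

/-- Landau's inequality on the line for a nonnegative function. -/
lemma sq_deriv_le_of_nonneg {f f' f'' : ℝ → ℝ} {g : ℝ} (hf0 : ∀ x, 0 ≤ f x)
    (hf : ∀ x, HasDerivAt f (f' x) x) (hf' : ∀ x, HasDerivAt f' (f'' x) x)
    (hg : ∀ x, f'' x ≤ g) (x : ℝ) : f' x ^ 2 ≤ 2 * g * f x := by
  set q : ℝ → ℝ := fun y => g / 2 * y ^ 2 - f y with hq
  have hq1 : ∀ y, HasDerivAt q (g * y - f' y) y := fun y => by
    have h := (((hasDerivAt_id y).pow 2).const_mul (g / 2)).sub (hf y)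
    refine h.congr_deriv ?_
    simp only [id]
    push_cast
    ring
  have hq2 : ∀ y, HasDerivAt (fun y => g * y - f' y) (g - f'' y) y := fun y => by
    have h := ((hasDerivAt_id y).const_mul g).sub (hf' y)
    exact h.congr_deriv (by rw [mul_one])
  have hderiv : deriv q = fun y => g * y - f' y := funext fun y => (hq1 y).deriv
  have hconv : ConvexOn ℝ univ q := by
    refine MonotoneOn.convexOn_of_deriv convex_univ
      (fun y _ => (hq1 y).continuousAt.continuousWithinAt)
      (fun y _ => (hq1 y).differentiableAt.differentiableWithinAt) ?_
    rw [hderiv]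
    exact (monotone_of_deriv_nonneg (fun y => (hq2 y).differentiableAt)
      fun y => by rw [(hq2 y).deriv]; linarith [hg y]).monotoneOn _
  have htan : ∀ y, q x + (g * x - f' x) * (y - x) ≤ q y := by
    intro y
    rcases lt_trichotomy x y with h | h | h
    · have := hconv.le_slope_of_hasDerivAt (mem_univ x) (mem_univ y) h (hq1 x)
      rw [slope_def_field, le_div_iff₀ (by linarith)] at this
      linarith
    · simp [h]
    · have := hconv.slope_le_of_hasDerivAt (mem_univ y) (mem_univ x) h (hq1 x)
      rw [slope_def_field, div_le_iff₀ (by linarith)] at this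
      linarith
  have hquad : ∀ y : ℝ, 0 ≤ g / 2 * (y * y) + f' x * y + f x := by
    intro y
    have h1 := htan (x + y)
    have h2 := hf0 (x + y)
    simp only [hq] at h1
    nlinarith
  have hd := discrim_le_zero hquad
  rw [discrim] at hd
  linarith

lemma abs_mul_le_of_sq_le {a p K g M ρ s : ℝ} (hK : 0 ≤ K) (hg : 0 ≤ g) (hM : 0 ≤ M)
    (hρ : 0 ≤ ρ) (ha : a ^ 2 * s ≤ K ^ 2 * ρ ^ 2) (hp : p ^ 2 ≤ 2 * g * (M * s)) :
    |a * p| ≤ (g + M) * K * ρ := by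
  refine abs_le_of_sq_le_sq ?_ (by positivity)
  calc (a * p) ^ 2 = a ^ 2 * p ^ 2 := by ring
    _ ≤ a ^ 2 * (2 * g * (M * s)) := mul_le_mul_of_nonneg_left hp (sq_nonneg a)
    _ = (2 * g * M) * (a ^ 2 * s) := by ring
    _ ≤ (2 * g * M) * (K ^ 2 * ρ ^ 2) := mul_le_mul_of_nonneg_left ha (by positivity)
    _ ≤ (g + M) ^ 2 * (K ^ 2 * ρ ^ 2) := by
        refine mul_le_mul_of_nonneg_right ?_ (by positivity)
        nlinarith [sq_nonneg g, sq_nonneg M]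
    _ = _ := by ring

/-- Integration by parts at a fixed time: the energy dissipation is bounded by the weighted energy
up to the factor controlled by the second derivatives. -/
lemma neg_integral_le_of_second_deriv_bound {a a' a'' c c' c'' φ φ' φ'' ρ : ℝ → ℝ} {g K M R : ℝ}
    (hR : 0 ≤ R) (hg : 0 ≤ g) (hK : 0 ≤ K) (hM : 0 ≤ M)
    (ha : ∀ x, HasDerivAt a (a' x) x) (ha' : ∀ x, HasDerivAt a' (a'' x) x)
    (hc : ∀ x, HasDerivAt c (c' x) x) (hc' : ∀ x, HasDerivAt c' (c'' x) x)
    (hφ : ∀ x, HasDerivAt φ (φ' x) x) (hφ' : ∀ x, HasDerivAt φ' (φ'' x) x)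
    (ha0 : ∀ x, 0 ≤ a x) (haM : ∀ x, a x ≤ M * (x ^ 2 + 1))
    (hag : ∀ x, |a'' x| ≤ g) (hcg : ∀ x, |c'' x| ≤ g)
    (hρ : Continuous ρ) (hφ0 : ∀ x, 0 ≤ φ x) (hφρ : ∀ x, φ x ≤ ρ x)
    (hφ1 : ∀ x, φ' x ^ 2 * (x ^ 2 + 1) ≤ K ^ 2 * ρ x ^ 2)
    (hφ2 : ∀ x, |φ'' x| * (x ^ 2 + 1) ≤ K * ρ x)
    (hφR : ∀ x, R ≤ |x| → φ x = 0 ∧ φ' x = 0) :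
    -(∫ x in (-R)..R, (((a' x - c' x) * φ x + (a x - c x) * φ' x) * (a x * a' x - c x * c' x)
      + (a x - c x) * φ x * (a' x ^ 2 - c' x ^ 2))) ≤
    2 * (K + 1) * (g + M) * ∫ x in (-R)..R, (a x - c x) ^ 2 * ρ x := by
  set N : ℝ → ℝ := fun x => ((a' x - c' x) * φ x + (a x - c x) * φ' x) * (a x * a' x - c x * c' x)
      + (a x - c x) * φ x * (a' x ^ 2 - c' x ^ 2) with hN
  set Z : ℝ → ℝ := fun x => -((a x - c x) * φ x * (a x * a' x - c x * c' x))
      + (a x - c x) * φ x * a x * (a' x - c' x)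
      - (1/2) * ((φ' x * a x + φ x * a' x) * (a x - c x) ^ 2) with hZ
  have hac : Continuous a := continuous_iff_continuousAt.2 fun x => (ha x).continuousAt
  have ha'c : Continuous a' := continuous_iff_continuousAt.2 fun x => (ha' x).continuousAt
  have hcc : Continuous c := continuous_iff_continuousAt.2 fun x => (hc x).continuousAt
  have hc'c : Continuous c' := continuous_iff_continuousAt.2 fun x => (hc' x).continuousAt
  have hφc : Continuous φ := continuous_iff_continuousAt.2 fun x => (hφ x).continuousAt
  have hφ'c : Continuous φ' := continuous_iff_continuousAt.2 fun x => (hφ' x).continuousAt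
  have hZ' : ∀ x, HasDerivAt Z (-N x - (a x - c x) ^ 2 * φ x * c'' x
      + φ x * a x * (a' x - c' x) ^ 2
      - (1/2) * ((φ'' x * a x + 2 * (φ' x * a' x) + φ x * a'' x) * (a x - c x) ^ 2)) x := by
    intro x
    have hw := (ha x).sub (hc x)
    have hw' := (ha' x).sub (hc' x)
    have h1 := (hw.mul (hφ x)).mul (((ha x).mul (ha' x)).sub ((hc x).mul (hc' x)))
    have h2 := (((hw.mul (hφ x)).mul (ha x)).mul hw')
    have h3 := ((((hφ' x).mul (ha x)).add ((hφ x).mul (ha' x))).mul (hw.pow 2)).const_mul (1/2)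
    have h := (h1.neg.add h2).sub h3
    refine h.congr_deriv ?_
    simp only [hN, Pi.sub_apply, Pi.mul_apply, Pi.add_apply, Pi.pow_apply]
    push_cast
    ring
  have hle : ∀ x, -N x - 2 * (K + 1) * (g + M) * ((a x - c x) ^ 2 * ρ x) ≤
      -N x - (a x - c x) ^ 2 * φ x * c'' x
      + φ x * a x * (a' x - c' x) ^ 2
      - (1/2) * ((φ'' x * a x + 2 * (φ' x * a' x) + φ x * a'' x) * (a x - c x) ^ 2) := by
    intro x
    have hρ0 : 0 ≤ ρ x := (hφ0 x).trans (hφρ x)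
    have hW : 0 ≤ (a x - c x) ^ 2 := sq_nonneg _
    have b1 : φ x * c'' x ≤ ρ x * g := (mul_le_mul_of_nonneg_left (le_of_abs_le (hcg x))
      (hφ0 x)).trans (mul_le_mul_of_nonneg_right (hφρ x) hg)
    have b2 : φ x * a'' x ≤ ρ x * g := (mul_le_mul_of_nonneg_left (le_of_abs_le (hag x))
      (hφ0 x)).trans (mul_le_mul_of_nonneg_right (hφρ x) hg)
    have b3 : φ' x * a' x ≤ (g + M) * K * ρ x := by
      refine le_of_abs_le (abs_mul_le_of_sq_le hK hg hM hρ0 (hφ1 x) ?_)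
      exact (sq_deriv_le_of_nonneg ha0 ha ha' (fun y => le_of_abs_le (hag y)) x).trans
        (mul_le_mul_of_nonneg_left (haM x) (by positivity))
    have b4 : φ'' x * a x ≤ M * (K * ρ x) :=
      calc φ'' x * a x ≤ |φ'' x| * (M * (x ^ 2 + 1)) :=
            mul_le_mul (le_abs_self _) (haM x) (ha0 x) (abs_nonneg _)
        _ = M * (|φ'' x| * (x ^ 2 + 1)) := by ring
        _ ≤ _ := mul_le_mul_of_nonneg_left (hφ2 x) hM
    have b5 : 0 ≤ φ x * a x * (a' x - c' x) ^ 2 :=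
      mul_nonneg (mul_nonneg (hφ0 x) (ha0 x)) (sq_nonneg _)
    have b6 : φ x * c'' x + (1/2) * (φ'' x * a x + 2 * (φ' x * a' x) + φ x * a'' x) ≤
        2 * (K + 1) * (g + M) * ρ x := by
      have p1 : 0 ≤ g * ρ x := mul_nonneg hg hρ0
      have p2 : 0 ≤ M * ρ x := mul_nonneg hM hρ0
      have p3 : 0 ≤ K * (g * ρ x) := mul_nonneg hK p1
      have p4 : 0 ≤ K * (M * ρ x) := mul_nonneg hK p2
      nlinarith
    have b7 := mul_le_mul_of_nonneg_left b6 hW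
    linarith
  have hcont : Continuous fun x => -N x - 2 * (K + 1) * (g + M) * ((a x - c x) ^ 2 * ρ x) := by
    fun_prop
  have hint := intervalIntegral.integral_le_sub_of_hasDeriv_right_of_le (a := -R) (b := R)
    (by linarith) (fun x _ => (hZ' x).continuousAt.continuousWithinAt)
    (fun x _ => (hZ' x).hasDerivWithinAt)
    (hcont.continuousOn.integrableOn_compact isCompact_Icc) (fun x _ => hle x)
  have hR1 := hφR R (le_abs_self R)
  have hR2 := hφR (-R) (by rw [abs_neg]; exact le_abs_self R)
  rw [intervalIntegral.integral_sub (Continuous.intervalIntegrable (by fun_prop) _ _)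
    (Continuous.intervalIntegrable (by fun_prop) _ _), intervalIntegral.integral_neg,
    intervalIntegral.integral_const_mul] at hint
  have hZ0 : Z R - Z (-R) = 0 := by
    simp [hZ, hR1.1, hR1.2, hR2.1, hR2.2]
  linarith

lemma hasDerivAt_max_zero_pow (n : ℕ) (y : ℝ) :
    HasDerivAt (fun y : ℝ => max y 0 ^ (n + 2)) ((n + 2) * max y 0 ^ (n + 1)) y := by
  rcases lt_trichotomy y 0 with h | h | h
  · have he : (fun y : ℝ => max y 0 ^ (n + 2)) =ᶠ[nhds y] fun _ => 0 := by
      filter_upwards [gt_mem_nhds h] with z hz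
      simp [max_eq_right hz.le]
    refine HasDerivAt.congr_of_eventuallyEq ?_ he
    simpa [max_eq_right h.le] using hasDerivAt_const y (0:ℝ)
  · subst h
    rw [hasDerivAt_iff_isLittleO]
    simp only [max_self, ne_eq, Nat.add_eq_zero_iff, OfNat.ofNat_ne_zero, and_false,
      not_false_eq_true, zero_pow, sub_zero, one_ne_zero, mul_zero, smul_zero]
    have h1 : (fun z : ℝ => max z 0 ^ (n + 2)) =O[nhds 0] fun z => z ^ (n + 2) := by
      refine Asymptotics.IsBigO.of_bound 1 (Eventually.of_forall fun z => ?_)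
      rw [norm_pow, norm_pow, one_mul]
      refine pow_le_pow_left₀ (norm_nonneg _) ?_ _
      rw [Real.norm_eq_abs, Real.norm_eq_abs, abs_of_nonneg (le_max_right z 0)]
      exact max_le (le_abs_self z) (abs_nonneg z)
    exact h1.trans_isLittleO (Asymptotics.isLittleO_pow_id (by omega))
  · have he : (fun y : ℝ => max y 0 ^ (n + 2)) =ᶠ[nhds y] fun y => y ^ (n + 2) := by
      filter_upwards [lt_mem_nhds h] with z hz
      simp [max_eq_left hz.le]
    refine HasDerivAt.congr_of_eventuallyEq ?_ he
    rw [max_eq_left h.le]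
    exact (hasDerivAt_pow (n + 2) y).congr_deriv (by push_cast; rfl)

/-- The compactly supported weights `((1 + x²)⁻¹ - ε)₊³`, whose derivatives are controlled by
`(1 + x²)⁻³` uniformly in `ε`. -/
lemma exists_derivs_cutoff {ε : ℝ} (hε : 0 < ε) :
    ∃ φ' φ'' : ℝ → ℝ,
      (∀ x : ℝ, HasDerivAt (fun x => max ((1 + x ^ 2)⁻¹ - ε) 0 ^ 3) (φ' x) x) ∧
      (∀ x, HasDerivAt φ' (φ'' x) x) ∧
      (∀ x, φ' x ^ 2 * (x ^ 2 + 1) ≤ 54 ^ 2 * ((1 + x ^ 2)⁻¹ ^ 3) ^ 2) ∧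
      (∀ x, |φ'' x| * (x ^ 2 + 1) ≤ 54 * (1 + x ^ 2)⁻¹ ^ 3) ∧
      (∀ x, ε⁻¹ + 1 ≤ |x| → max ((1 + x ^ 2)⁻¹ - ε) 0 = 0 ∧ φ' x = 0) := by
  have hsne : ∀ x : ℝ, 1 + x ^ 2 ≠ 0 := fun x => by positivity
  have hV : ∀ x : ℝ, HasDerivAt (fun x : ℝ => (1 + x ^ 2)⁻¹ - ε)
      (-(2 * x) * (1 + x ^ 2)⁻¹ ^ 2) x := fun x => by
    have h := ((((hasDerivAt_id x).pow 2).const_add 1).inv (hsne x)).sub_const ε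
    refine h.congr_deriv ?_
    simp [div_eq_mul_inv]
  have hr : ∀ x : ℝ, HasDerivAt (fun x : ℝ => -(2 * x) * (1 + x ^ 2)⁻¹ ^ 2)
      (-2 * (1 + x ^ 2)⁻¹ ^ 2 + 8 * x ^ 2 * (1 + x ^ 2)⁻¹ ^ 3) x := fun x => by
    have h1 := ((((hasDerivAt_id x).pow 2).const_add 1).inv (hsne x)).pow 2
    have h := (((hasDerivAt_id x).const_mul 2).neg).mul h1
    refine h.congr_deriv ?_
    have := hsne x
    simp only [Pi.pow_apply, Pi.inv_apply, Pi.neg_apply, id, Nat.cast_ofNat, Nat.reduceSub, pow_one]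
    field_simp
    ring
  have hm : ∀ x : ℝ, 0 ≤ max ((1 + x ^ 2)⁻¹ - ε) 0 := fun x => le_max_right _ _
  have hmle : ∀ x : ℝ, max ((1 + x ^ 2)⁻¹ - ε) 0 ≤ (1 + x ^ 2)⁻¹ := fun x =>
    max_le (by linarith) (by positivity)
  have hm0 : ∀ x : ℝ, ε⁻¹ + 1 ≤ |x| → max ((1 + x ^ 2)⁻¹ - ε) 0 = 0 := by
    intro x hx
    refine max_eq_right (sub_nonpos.2 (inv_le_of_inv_le₀ hε ?_))
    have : 0 < ε⁻¹ := by positivity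
    have h2 : (ε⁻¹ + 1) ^ 2 ≤ |x| ^ 2 := pow_le_pow_left₀ (by positivity) hx 2
    rw [sq_abs] at h2
    nlinarith
  refine ⟨fun x => 3 * max ((1 + x ^ 2)⁻¹ - ε) 0 ^ 2 * (-(2 * x) * (1 + x ^ 2)⁻¹ ^ 2),
    fun x => 3 * (2 * max ((1 + x ^ 2)⁻¹ - ε) 0 * (-(2 * x) * (1 + x ^ 2)⁻¹ ^ 2))
        * (-(2 * x) * (1 + x ^ 2)⁻¹ ^ 2)
      + 3 * max ((1 + x ^ 2)⁻¹ - ε) 0 ^ 2 *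
        (-2 * (1 + x ^ 2)⁻¹ ^ 2 + 8 * x ^ 2 * (1 + x ^ 2)⁻¹ ^ 3), ?_, ?_, ?_, ?_, ?_⟩
  · intro x
    refine ((hasDerivAt_max_zero_pow 1 _).comp x (hV x)).congr_deriv ?_
    norm_num
  · intro x
    refine ((((hasDerivAt_max_zero_pow 0 _).comp x (hV x)).const_mul 3).mul (hr x)).congr_deriv ?_
    norm_num
  · intro x
    set m := max ((1 + x ^ 2)⁻¹ - ε) 0 with hmdef
    set i := (1 + x ^ 2)⁻¹ with hi
    have hi0 : 0 < i := by positivity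
    have his : i * (x ^ 2 + 1) = 1 := by rw [hi, add_comm]; exact inv_mul_cancel₀ (by positivity)
    have hix : i * x ^ 2 ≤ 1 := by nlinarith
    have h1 : m ^ 4 ≤ i ^ 4 := pow_le_pow_left₀ (hm x) (hmle x) 4
    calc (3 * m ^ 2 * (-(2 * x) * i ^ 2)) ^ 2 * (x ^ 2 + 1)
        = 36 * (m ^ 4 * ((i * x ^ 2) * (i * (x ^ 2 + 1)) * i ^ 2)) := by ring
      _ ≤ 36 * (i ^ 4 * (1 * 1 * i ^ 2)) := by
          rw [his]
          gcongr
      _ ≤ 54 ^ 2 * (i ^ 3) ^ 2 := by nlinarith [pow_pos hi0 6]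
  · intro x
    set m := max ((1 + x ^ 2)⁻¹ - ε) 0 with hmdef
    set i := (1 + x ^ 2)⁻¹ with hi
    have hi0 : 0 < i := by positivity
    have hm0' : 0 ≤ m := hm x
    have hmi : m ≤ i := hmle x
    have his : i * (x ^ 2 + 1) = 1 := by rw [hi, add_comm]; exact inv_mul_cancel₀ (by positivity)
    have hix : i * x ^ 2 ≤ 1 := by nlinarith
    have hix0 : 0 ≤ i * x ^ 2 := by positivity
    have h2 : |-2 * i ^ 2 + 8 * x ^ 2 * i ^ 3| ≤ 10 * i ^ 2 := by
      have e : -2 * i ^ 2 + 8 * x ^ 2 * i ^ 3 = (-2 + 8 * (i * x ^ 2)) * i ^ 2 := by ring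
      rw [e, abs_mul, abs_of_pos (pow_pos hi0 2)]
      refine mul_le_mul_of_nonneg_right ?_ (by positivity)
      rw [abs_le]
      constructor <;> linarith
    have h3 : |3 * (2 * m * (-(2 * x) * i ^ 2)) * (-(2 * x) * i ^ 2)
        + 3 * m ^ 2 * (-2 * i ^ 2 + 8 * x ^ 2 * i ^ 3)| ≤ 54 * i ^ 4 := by
      refine (abs_add_le _ _).trans ?_
      have e : 3 * (2 * m * (-(2 * x) * i ^ 2)) * (-(2 * x) * i ^ 2) =
          24 * (m * (i * x ^ 2) * i ^ 3) := by ring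
      rw [e, abs_of_nonneg (by positivity), abs_mul, abs_of_nonneg (by positivity)]
      calc 24 * (m * (i * x ^ 2) * i ^ 3) + 3 * m ^ 2 * |-2 * i ^ 2 + 8 * x ^ 2 * i ^ 3|
          ≤ 24 * (i * 1 * i ^ 3) + 3 * i ^ 2 * (10 * i ^ 2) := by gcongr
        _ = 54 * i ^ 4 := by ring
    calc _ ≤ 54 * i ^ 4 * (x ^ 2 + 1) := mul_le_mul_of_nonneg_right h3 (by positivity)
      _ = 54 * (i ^ 3 * (i * (x ^ 2 + 1))) := by ring
      _ = 54 * i ^ 3 := by rw [his, mul_one]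
  · intro x hx
    simp [hm0 x hx]

/-- Gronwall's lemma with an integrable kernel and zero initial value. -/
lemma eq_zero_of_le_integral_mul {E k : ℝ → ℝ} {b : ℝ} (hE : Continuous E) (hE0 : ∀ t, 0 ≤ E t)
    (hk0 : ∀ t, 0 ≤ k t) (hk : IntervalIntegrable k volume 0 b)
    (h : ∀ t ∈ Icc 0 b, E t ≤ ∫ s in (0:ℝ)..t, k s * E s) : ∀ t ∈ Icc 0 b, E t = 0 := by
  set F : ℝ → ℝ := fun t => ∫ s in (0:ℝ)..t, k s with hF
  have hki : ∀ r ∈ Icc 0 b, ∀ t ∈ Icc 0 b, IntervalIntegrable k volume r t := by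
    intro r hr t ht
    have hb : 0 ≤ b := hr.1.trans hr.2
    refine hk.mono_set ?_
    rw [uIcc_of_le hb]
    exact ordConnected_Icc.uIcc_subset hr ht
  have hFadd : ∀ r ∈ Icc 0 b, ∀ t ∈ Icc 0 b, ∫ s in r..t, k s = F t - F r := by
    intro r hr t ht
    have h0 : (0:ℝ) ∈ Icc 0 b := ⟨le_rfl, hr.1.trans hr.2⟩
    exact (intervalIntegral.integral_interval_sub_left (hki 0 h0 t ht) (hki 0 h0 r hr)).symm
  have hFmono : ∀ r ∈ Icc 0 b, ∀ t ∈ Icc 0 b, r ≤ t → F r ≤ F t := by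
    intro r hr t ht hrt
    have := intervalIntegral.integral_nonneg hrt (fun s _ => hk0 s) (μ := volume)
    rw [hFadd r hr t ht] at this
    linarith
  have hFc : ContinuousOn F (Icc 0 b) := by
    by_cases hb : 0 ≤ b
    · have := intervalIntegral.continuousOn_primitive_interval (a := 0) (b := b) (f := k)
        (μ := volume) (by
          rw [uIcc_of_le hb]
          exact (intervalIntegrable_iff_integrableOn_Icc_of_le hb).1 hk)
      rwa [uIcc_of_le hb] at this
    · rw [Icc_eq_empty hb]
      exact continuousOn_empty _
  have hF0 : F 0 = 0 := by simp [hF]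
  have main : ∀ n : ℕ, ∀ t ∈ Icc 0 b, F t ≤ n / 2 → E t = 0 := by
    intro n
    induction n with
    | zero =>
      intro t ht hFt
      rw [Nat.cast_zero, zero_div] at hFt
      obtain ⟨r, hr, hmax⟩ := isCompact_Icc.exists_isMaxOn ⟨t, ht.1, le_rfl⟩
        (hE.continuousOn (s := Icc 0 t))
      have hmax' : ∀ s ∈ Icc 0 t, E s ≤ E r := fun s hs => hmax hs
      have h0 : (0:ℝ) ∈ Icc 0 b := ⟨le_rfl, ht.1.trans ht.2⟩
      have h1 : ∫ s in (0:ℝ)..t, k s * E s ≤ ∫ s in (0:ℝ)..t, k s * E r :=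
        intervalIntegral.integral_mono_on ht.1
          ((hki 0 h0 t ht).mul_continuousOn hE.continuousOn) ((hki 0 h0 t ht).mul_const _)
          fun s hs => mul_le_mul_of_nonneg_left (hmax' s hs) (hk0 s)
      rw [intervalIntegral.integral_mul_const] at h1
      have h2 := h t ht
      have h3 : F t * E r ≤ 0 := mul_nonpos_of_nonpos_of_nonneg hFt (hE0 r)
      linarith [hE0 t]
    | succ n ih =>
      intro t ht hFt
      have h0 : (0:ℝ) ∈ Icc 0 b := ⟨le_rfl, ht.1.trans ht.2⟩
      by_cases hle : F t ≤ n / 2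
      · exact ih t ht hle
      have hsub : Icc 0 t ⊆ Icc 0 b := Icc_subset_Icc_right ht.2
      obtain ⟨r, hr, hFr⟩ : (n / 2 : ℝ) ∈ F '' Icc 0 t :=
        intermediate_value_Icc ht.1 (hFc.mono hsub)
          ⟨by rw [hF0]; positivity, (not_le.1 hle).le⟩
      have hrb := hsub hr
      have hz : ∀ s ∈ Icc 0 r, E s = 0 := fun s hs =>
        ih s ⟨hs.1, hs.2.trans hrb.2⟩
          ((hFmono s ⟨hs.1, hs.2.trans hrb.2⟩ r hrb hs.2).trans hFr.le)
      obtain ⟨q, hq, hmax⟩ := isCompact_Icc.exists_isMaxOn ⟨t, hr.2, le_rfl⟩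
        (hE.continuousOn (s := Icc r t))
      have hmax' : ∀ s ∈ Icc r t, E s ≤ E q := fun s hs => hmax hs
      have hqb : q ∈ Icc 0 b := ⟨hr.1.trans hq.1, hq.2.trans ht.2⟩
      have h1 : ∫ s in r..q, k s * E s ≤ ∫ s in r..q, k s * E q :=
        intervalIntegral.integral_mono_on hq.1
          ((hki r hrb q hqb).mul_continuousOn hE.continuousOn) ((hki r hrb q hqb).mul_const _)
          fun s hs => mul_le_mul_of_nonneg_left (hmax' s ⟨hs.1, hs.2.trans hq.2⟩) (hk0 s)
      have h2 : ∫ s in (0:ℝ)..r, k s * E s = 0 := by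
        refine (intervalIntegral.integral_congr (g := fun _ => (0:ℝ)) fun s hs => ?_).trans
          (by simp)
        rw [uIcc_of_le hr.1] at hs
        simp [hz s hs]
      have h3 := intervalIntegral.integral_add_adjacent_intervals
        ((hki 0 h0 r hrb).mul_continuousOn (g := E) hE.continuousOn)
        ((hki r hrb q hqb).mul_continuousOn (g := E) hE.continuousOn)
      rw [intervalIntegral.integral_mul_const, hFadd r hrb q hqb, hFr] at h1
      have h4 := h q hqb
      have h5 := hFmono q hqb t ht hq.2
      push_cast at hFt
      have h6 : (F q - n / 2) * E q ≤ 1 / 2 * E q :=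
        mul_le_mul_of_nonneg_right (by linarith) (hE0 q)
      have h7 := hmax' t ⟨hr.2, le_rfl⟩
      linarith [hE0 t, hE0 q]
  intro t ht
  obtain ⟨n, hn⟩ := exists_nat_ge (2 * F t)
  exact main n t ht (by linarith)

lemma IsStrongSolution.weak_identity {T T' : ℝ} {u U P : ℝ → ℝ → ℝ}
    (h : IsStrongSolution T u) (h0 : 0 < T') (hT : T' < T)
    (hU : Continuous (Function.uncurry U)) (hP : Continuous (Function.uncurry P))
    (hUP : ∀ t x, HasDerivAt (U t) (P t x) x)
    (hu : ∀ t ∈ Icc 0 T', U t = u t ∧ P t = deriv (u t))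
    {η η' : ℝ → ℝ} (hη'c : Continuous η') (hη : ∀ x, HasDerivAt η (η' x) x)
    {R : ℝ} (hR : 0 < R) (hηR : ∀ x, R ≤ |x| + 1 → η x = 0)
    {s t : ℝ} (hs : s ∈ Icc 0 T') (ht : t ∈ Icc 0 T') :
    (∫ x in (-R)..R, U t x * η x) - (∫ x in (-R)..R, U s x * η x) =
      -∫ r in s..t, ∫ x in (-R)..R,
        (1/2) * (η' x * (U r x * P r x) + η x * (P r x) ^ 2) := by
  have hηc : Continuous η := continuous_iff_continuousAt.2 fun x => (hη x).continuousAt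
  have key : ∀ t ∈ Icc 0 T', _ := fun t ht =>
    weak_identity_of_smooth hU hP (t := t) ht.1 hR
      (fun ζ hζ hζR => h.weak_identity_smooth h0 hT hU hP hUP hu hζ hR hζR ht) hη'c hη hηR
  have hc : Continuous fun s => ∫ x in (-R)..R,
        (1/2) * (η' x * (U s x * P s x) + η x * (P s x) ^ 2) :=
    intervalIntegral.continuous_parametric_intervalIntegral_of_continuous' (by fun_prop) _ _
  rw [key t ht, key s hs, ← intervalIntegral.integral_interval_sub_left
    (hc.intervalIntegrable 0 t) (hc.intervalIntegrable 0 s)]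
  ring

/-- The localized energy inequality for the difference of two strong solutions. -/
lemma localized_energy_le {T T' : ℝ} {u₁ u₂ U₁ U₂ P₁ P₂ : ℝ → ℝ → ℝ}
    (h₁ : IsStrongSolution T u₁) (h₂ : IsStrongSolution T u₂) (h0 : 0 < T') (hT : T' < T)
    (hU₁ : Continuous (Function.uncurry U₁)) (hP₁ : Continuous (Function.uncurry P₁))
    (hUP₁ : ∀ t x, HasDerivAt (U₁ t) (P₁ t x) x)
    (hu₁ : ∀ t ∈ Icc 0 T', U₁ t = u₁ t ∧ P₁ t = deriv (u₁ t))
    (hU₂ : Continuous (Function.uncurry U₂)) (hP₂ : Continuous (Function.uncurry P₂))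
    (hUP₂ : ∀ t x, HasDerivAt (U₂ t) (P₂ t x) x)
    (hu₂ : ∀ t ∈ Icc 0 T', U₂ t = u₂ t ∧ P₂ t = deriv (u₂ t))
    (hinit : ∀ x, U₁ 0 x = U₂ 0 x)
    {M : ℝ} (hM : 0 ≤ M) (hUM : ∀ t x, 0 ≤ U₁ t x ∧ U₁ t x ≤ M * (x ^ 2 + 1))
    {g E : ℝ → ℝ} (hg0 : ∀ t, 0 ≤ g t) (hg : IntegrableOn g (Icc 0 T'))
    (hgd : ∀ᵐ t ∂(volume.restrict (Ioc 0 T')), ∀ x,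
      (DifferentiableAt ℝ (deriv (u₁ t)) x ∧ |deriv (deriv (u₁ t)) x| ≤ g t) ∧
      (DifferentiableAt ℝ (deriv (u₂ t)) x ∧ |deriv (deriv (u₂ t)) x| ≤ g t))
    (hEc : Continuous E)
    (hE : ∀ R, 0 < R → ∀ t,
      ∫ x in (-R)..R, (U₁ t x - U₂ t x) ^ 2 * (1 + x ^ 2)⁻¹ ^ 3 ≤ E t)
    {ε : ℝ} (hε : 0 < ε) {t : ℝ} (ht : t ∈ Icc 0 T') :
    ∫ x, (U₁ t x - U₂ t x) ^ 2 * max ((1 + x ^ 2)⁻¹ - ε) 0 ^ 3 ≤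
      ∫ s in (0:ℝ)..t, 2 * (54 + 1) * (g s + M) * E s := by
  obtain ⟨φ', φ'', hφ, hφ', hφ1, hφ2, hφR⟩ := exists_derivs_cutoff hε
  set φ : ℝ → ℝ := fun x => max ((1 + x ^ 2)⁻¹ - ε) 0 ^ 3 with hφdef
  set R := ε⁻¹ + 2 with hRdef
  have hR : 0 < R := by positivity
  have hφz : ∀ x, ε⁻¹ + 1 ≤ |x| → φ x = 0 ∧ φ' x = 0 := fun x hx =>
    ⟨by simp [hφdef, (hφR x hx).1], (hφR x hx).2⟩
  have hφ'c : Continuous φ' := continuous_iff_continuousAt.2 fun x => (hφ' x).continuousAt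
  have hφc : Continuous φ := continuous_iff_continuousAt.2 fun x => (hφ x).continuousAt
  have hρc : Continuous fun x : ℝ => (1 + x ^ 2)⁻¹ ^ 3 :=
    ((continuous_const.add (continuous_id.pow 2)).inv₀
      fun x : ℝ => (by positivity : (1 : ℝ) + x ^ 2 ≠ 0)).pow 3
  set w : ℝ → ℝ → ℝ := fun t x => U₁ t x - U₂ t x with hw
  set p : ℝ → ℝ → ℝ := fun t x => P₁ t x - P₂ t x with hp
  set Q : ℝ → ℝ → ℝ := fun t x => (1/2) * (U₁ t x * P₁ t x - U₂ t x * P₂ t x) with hQ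
  set k : ℝ → ℝ → ℝ := fun t x => (1/2) * (P₁ t x ^ 2 - P₂ t x ^ 2) with hk
  have hwc : Continuous (Function.uncurry w) := by fun_prop
  have hpc : Continuous (Function.uncurry p) := by fun_prop
  have hQc : Continuous (Function.uncurry Q) := by fun_prop
  have hkc : Continuous (Function.uncurry k) := by fun_prop
  set F : ℝ → ℝ := fun t =>
    -2 * ∫ x in (-R)..R, ((p t x * φ x + w t x * φ' x) * Q t x + w t x * φ x * k t x) with hF
  have hFc : Continuous F := continuous_const.mul
    (intervalIntegral.continuous_parametric_intervalIntegral_of_continuous' (by fun_prop) _ _)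
  have hEεc : Continuous fun t => ∫ x in (-R)..R, w t x ^ 2 * φ x :=
    intervalIntegral.continuous_parametric_intervalIntegral_of_continuous' (by fun_prop) _ _
  have hderiv : ∀ t ∈ Ioo 0 T', HasDerivAt (fun t => ∫ x in (-R)..R, w t x ^ 2 * φ x) (F t) t := by
    intro t ht
    refine hasDerivAt_integral_sq_mul (b := T') hwc hpc hQc hkc
      (fun t x => (hUP₁ t x).sub (hUP₂ t x)) hφ'c hφ
      (fun x hx => (hφz x (by linarith)).1) ?_ ht
    intro η η' hη'c hη hηR s hs t ht
    have hηc : Continuous η := continuous_iff_continuousAt.2 fun x => (hη x).continuousAt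
    have e1 := h₁.weak_identity h0 hT hU₁ hP₁ hUP₁ hu₁ hη'c hη hR hηR hs ht
    have e2 := h₂.weak_identity h0 hT hU₂ hP₂ hUP₂ hu₂ hη'c hη hR hηR hs ht
    have hc : ∀ U P : ℝ → ℝ → ℝ, Continuous (Function.uncurry U) →
        Continuous (Function.uncurry P) → Continuous fun r => ∫ x in (-R)..R,
          (1/2) * (η' x * (U r x * P r x) + η x * (P r x) ^ 2) := fun U P hU hP =>
      intervalIntegral.continuous_parametric_intervalIntegral_of_continuous' (by fun_prop) _ _
    have e3 : ∀ t, ∫ x in (-R)..R, w t x * η x =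
        (∫ x in (-R)..R, U₁ t x * η x) - ∫ x in (-R)..R, U₂ t x * η x := by
      intro t
      rw [← intervalIntegral.integral_sub (Continuous.intervalIntegrable (by fun_prop) _ _)
        (Continuous.intervalIntegrable (by fun_prop) _ _)]
      exact intervalIntegral.integral_congr fun x _ => by simp only [hw]; ring
    have e4 : ∀ r, ∫ x in (-R)..R, (η' x * Q r x + η x * k r x) =
        (∫ x in (-R)..R, (1/2) * (η' x * (U₁ r x * P₁ r x) + η x * (P₁ r x) ^ 2)) -
        ∫ x in (-R)..R, (1/2) * (η' x * (U₂ r x * P₂ r x) + η x * (P₂ r x) ^ 2) := by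
      intro r
      rw [← intervalIntegral.integral_sub (Continuous.intervalIntegrable (by fun_prop) _ _)
        (Continuous.intervalIntegrable (by fun_prop) _ _)]
      exact intervalIntegral.integral_congr fun x _ => by simp only [hQ, hk]; ring
    simp only [e3, e4]
    rw [intervalIntegral.integral_sub ((hc _ _ hU₁ hP₁).intervalIntegrable _ _)
      ((hc _ _ hU₂ hP₂).intervalIntegrable _ _)]
    linarith
  have hbound : ∀ᵐ s ∂(volume.restrict (Ioc 0 T')), F s ≤ 2 * (54 + 1) * (g s + M) * E s := by
    filter_upwards [hgd, ae_restrict_mem measurableSet_Ioc] with s hs hsI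
    obtain ⟨e1, e2⟩ := hu₁ s (Ioc_subset_Icc_self hsI)
    obtain ⟨e3, e4⟩ := hu₂ s (Ioc_subset_Icc_self hsI)
    have hest := neg_integral_le_of_second_deriv_bound (a := U₁ s) (a' := P₁ s)
      (a'' := deriv (P₁ s)) (c := U₂ s) (c' := P₂ s) (c'' := deriv (P₂ s)) (φ := φ) (φ' := φ')
      (φ'' := φ'') (ρ := fun x => (1 + x ^ 2)⁻¹ ^ 3) (g := g s) (K := 54) (M := M) (R := R)
      hR.le (hg0 s) (by norm_num) hM (hUP₁ s)
      (fun x => by rw [e2]; exact (hs x).1.1.hasDerivAt) (hUP₂ s)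
      (fun x => by rw [e4]; exact (hs x).2.1.hasDerivAt) hφ hφ'
      (fun x => (hUM s x).1) (fun x => (hUM s x).2)
      (fun x => by rw [e2]; exact (hs x).1.2) (fun x => by rw [e4]; exact (hs x).2.2)
      hρc (fun x => pow_nonneg (le_max_right _ _) 3)
      (fun x => pow_le_pow_left₀ (le_max_right _ _)
        (max_le (by linarith) (by positivity)) 3)
      hφ1 hφ2 (fun x hx => hφz x (by linarith))
    have hFs : F s = -(∫ x in (-R)..R, (((P₁ s x - P₂ s x) * φ x + (U₁ s x - U₂ s x) * φ' x)
        * (U₁ s x * P₁ s x - U₂ s x * P₂ s x)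
        + (U₁ s x - U₂ s x) * φ x * (P₁ s x ^ 2 - P₂ s x ^ 2))) := by
      simp only [hF]
      rw [← intervalIntegral.integral_const_mul, ← intervalIntegral.integral_neg]
      exact intervalIntegral.integral_congr fun x _ => by simp only [hQ, hk, hw, hp]; ring
    rw [hFs]
    refine hest.trans (mul_le_mul_of_nonneg_left (hE R hR s) ?_)
    have := hg0 s
    positivity
  have hftc := intervalIntegral.integral_eq_sub_of_hasDerivAt_of_le ht.1 hEεc.continuousOn
    (fun s hs => hderiv s ⟨hs.1, hs.2.trans_le ht.2⟩) (hFc.intervalIntegrable _ _)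
  have hz : ∫ x in (-R)..R, w 0 x ^ 2 * φ x = 0 := by
    simp [hw, hinit]
  have hfull : ∫ x, (U₁ t x - U₂ t x) ^ 2 * max ((1 + x ^ 2)⁻¹ - ε) 0 ^ 3 =
      ∫ x in (-R)..R, w t x ^ 2 * φ x :=
    integral_eq_intervalIntegral_of_eq_zero hR.le fun x hx => by
      simp [(hφR x (by linarith)).1]
  rw [hz, sub_zero] at hftc
  rw [hfull, ← hftc, intervalIntegral.integral_of_le ht.1, intervalIntegral.integral_of_le ht.1]
  have hgt : IntegrableOn g (Icc 0 t) := hg.mono_set (Icc_subset_Icc_right ht.2)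
  have hint : IntegrableOn (fun s => 2 * (54 + 1) * (g s + M) * E s) (Icc 0 t) :=
    IntegrableOn.mul_continuousOn
      ((hgt.add continuous_const.integrableOn_Icc).const_mul (2 * (54 + 1)))
      hEc.continuousOn isCompact_Icc
  exact setIntegral_mono_ae_restrict (hFc.integrableOn_Icc.mono_set Ioc_subset_Icc_self)
    (hint.mono_set Ioc_subset_Icc_self)
    (ae_restrict_of_ae_restrict_of_subset (Ioc_subset_Ioc_right ht.2) hbound)

lemma IsStrongSolution.eqOn_Icc {T T' : ℝ} {u₁ u₂ : ℝ → ℝ → ℝ}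
    (h₁ : IsStrongSolution T u₁) (h₂ : IsStrongSolution T u₂)
    (hinit : ∀ x, u₁ 0 x = u₂ 0 x) (h0 : 0 < T') (hT : T' < T) :
    ∀ t ∈ Icc 0 T', ∀ x, u₁ t x = u₂ t x := by
  obtain ⟨U₁, P₁, hU₁, hP₁, hUP₁, hu₁, hcl₁⟩ := h₁.exists_extension h0 hT
  obtain ⟨U₂, P₂, hU₂, hP₂, hUP₂, hu₂, hcl₂⟩ := h₂.exists_extension h0 hT
  obtain ⟨⟨M₁, hM₁⟩, g₁, hg₁, hgd₁⟩ := h₁.2 T' h0 hT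
  obtain ⟨⟨M₂, hM₂⟩, g₂, hg₂, hgd₂⟩ := h₂.2 T' h0 hT
  set M := |M₁| + |M₂| with hMdef
  have hM : 0 ≤ M := by positivity
  have hUM₁ : ∀ t x, 0 ≤ U₁ t x ∧ U₁ t x ≤ M * (x ^ 2 + 1) := by
    intro t x
    obtain ⟨t', ht', e⟩ := hcl₁ t
    rw [e]
    refine ⟨h₁.1.1 t' ⟨ht'.1, ht'.2.trans_lt hT⟩ x, (hM₁ t' ht' x).trans ?_⟩
    exact mul_le_mul_of_nonneg_right (by linarith [le_abs_self M₁, abs_nonneg M₂]) (by positivity)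
  have hUM₂ : ∀ t x, 0 ≤ U₂ t x ∧ U₂ t x ≤ M * (x ^ 2 + 1) := by
    intro t x
    obtain ⟨t', ht', e⟩ := hcl₂ t
    rw [e]
    refine ⟨h₂.1.1 t' ⟨ht'.1, ht'.2.trans_lt hT⟩ x, (hM₂ t' ht' x).trans ?_⟩
    exact mul_le_mul_of_nonneg_right (by linarith [le_abs_self M₂, abs_nonneg M₁]) (by positivity)
  set w : ℝ → ℝ → ℝ := fun t x => U₁ t x - U₂ t x with hw
  have hwc : Continuous (Function.uncurry w) := by fun_prop
  have hic : Continuous fun x : ℝ => (1 + x ^ 2)⁻¹ :=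
    (continuous_const.add (continuous_id.pow 2)).inv₀
      fun x : ℝ => (by positivity : (1 : ℝ) + x ^ 2 ≠ 0)
  have hdom : ∀ t x, w t x ^ 2 * (1 + x ^ 2)⁻¹ ^ 3 ≤ M ^ 2 * (1 + x ^ 2)⁻¹ := by
    intro t x
    have h1 := hUM₁ t x
    have h2 := hUM₂ t x
    have h3 : w t x ^ 2 ≤ (M * (1 + x ^ 2)) ^ 2 := by
      refine sq_le_sq' ?_ ?_ <;> simp only [hw] <;> linarith
    calc _ ≤ (M * (1 + x ^ 2)) ^ 2 * (1 + x ^ 2)⁻¹ ^ 3 :=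
          mul_le_mul_of_nonneg_right h3 (by positivity)
      _ = _ := by field_simp
  have hdomi : Integrable fun x : ℝ => M ^ 2 * (1 + x ^ 2)⁻¹ := integrable_inv_one_add_sq.const_mul _
  have hnn : ∀ t x, 0 ≤ w t x ^ 2 * (1 + x ^ 2)⁻¹ ^ 3 := fun t x => by positivity
  have hxc : ∀ t, Continuous fun x => w t x ^ 2 * (1 + x ^ 2)⁻¹ ^ 3 := fun t => by fun_prop
  have hint : ∀ t, Integrable fun x => w t x ^ 2 * (1 + x ^ 2)⁻¹ ^ 3 := fun t =>
    hdomi.mono' (hxc t).aestronglyMeasurable (Eventually.of_forall fun x => by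
      rw [Real.norm_eq_abs, abs_of_nonneg (hnn t x)]
      exact hdom t x)
  set E : ℝ → ℝ := fun t => ∫ x, w t x ^ 2 * (1 + x ^ 2)⁻¹ ^ 3 with hE
  have hEc : Continuous E := by
    refine continuous_of_dominated (fun t => (hxc t).aestronglyMeasurable)
      (fun t => Eventually.of_forall fun x => ?_) hdomi (Eventually.of_forall fun x => ?_)
    · rw [Real.norm_eq_abs, abs_of_nonneg (hnn t x)]
      exact hdom t x
    · fun_prop
  have hEle : ∀ R, 0 < R → ∀ t, ∫ x in (-R)..R, w t x ^ 2 * (1 + x ^ 2)⁻¹ ^ 3 ≤ E t := by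
    intro R hR t
    rw [intervalIntegral.integral_of_le (by linarith)]
    exact setIntegral_le_integral (hint t) (Eventually.of_forall (hnn t))
  set g : ℝ → ℝ := fun t => |g₁ t| + |g₂ t| with hg
  have hg0 : ∀ t, 0 ≤ g t := fun t => by positivity
  have hgi : IntegrableOn g (Icc 0 T') := hg₁.abs.add hg₂.abs
  have hgd : ∀ᵐ t ∂(volume.restrict (Ioc 0 T')), ∀ x,
      (DifferentiableAt ℝ (deriv (u₁ t)) x ∧ |deriv (deriv (u₁ t)) x| ≤ g t) ∧
      (DifferentiableAt ℝ (deriv (u₂ t)) x ∧ |deriv (deriv (u₂ t)) x| ≤ g t) := by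
    filter_upwards [hgd₁, hgd₂] with t ht1 ht2 x
    refine ⟨⟨(ht1.1 x).2, (ht1.2 x).trans ?_⟩, ⟨(ht2.1 x).2, (ht2.2 x).trans ?_⟩⟩
    · simp only [hg]
      linarith [le_abs_self (g₁ t), abs_nonneg (g₂ t)]
    · simp only [hg]
      linarith [le_abs_self (g₂ t), abs_nonneg (g₁ t)]
  have hzero : (0:ℝ) ∈ Icc 0 T' := ⟨le_rfl, h0.le⟩
  have hinit' : ∀ x, U₁ 0 x = U₂ 0 x := fun x => by
    rw [(hu₁ 0 hzero).1, (hu₂ 0 hzero).1, hinit x]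
  have hgron : ∀ t ∈ Icc 0 T', E t ≤ ∫ s in (0:ℝ)..t, 2 * (54 + 1) * (g s + M) * E s := by
    intro t ht
    have hlim : Tendsto (fun n : ℕ =>
        ∫ x, w t x ^ 2 * max ((1 + x ^ 2)⁻¹ - 1 / ((n:ℝ) + 1)) 0 ^ 3) atTop (nhds (E t)) := by
      refine tendsto_integral_of_dominated_convergence (fun x => M ^ 2 * (1 + x ^ 2)⁻¹)
        (fun n => Continuous.aestronglyMeasurable (by fun_prop)) hdomi
        (fun n => Eventually.of_forall fun x => ?_) (Eventually.of_forall fun x => ?_)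
      · have hm : 0 ≤ max ((1 + x ^ 2)⁻¹ - 1 / ((n:ℝ) + 1)) 0 := le_max_right _ _
        have hmle : max ((1 + x ^ 2)⁻¹ - 1 / ((n:ℝ) + 1)) 0 ≤ (1 + x ^ 2)⁻¹ :=
          max_le (by linarith [(by positivity : 0 ≤ 1 / ((n:ℝ) + 1))]) (by positivity)
        rw [Real.norm_eq_abs, abs_of_nonneg (by positivity)]
        exact (mul_le_mul_of_nonneg_left (pow_le_pow_left₀ hm hmle 3) (sq_nonneg _)).trans
          (hdom t x)
      · have h1 : Tendsto (fun n : ℕ => max ((1 + x ^ 2)⁻¹ - 1 / ((n:ℝ) + 1)) 0) atTop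
            (nhds (max ((1 + x ^ 2)⁻¹ - 0) 0)) :=
          (tendsto_const_nhds.sub tendsto_one_div_add_atTop_nhds_zero_nat).max tendsto_const_nhds
        rw [sub_zero, max_eq_left (by positivity)] at h1
        exact (h1.pow 3).const_mul _
    refine le_of_tendsto hlim (Eventually.of_forall fun n => ?_)
    exact localized_energy_le h₁ h₂ h0 hT hU₁ hP₁ hUP₁ hu₁ hU₂ hP₂ hUP₂ hu₂ hinit' hM hUM₁ hg0
      hgi hgd hEc hEle (by positivity) ht
  have hk : IntervalIntegrable (fun s => 2 * (54 + 1) * (g s + M)) volume 0 T' := by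
    rw [intervalIntegrable_iff_integrableOn_Icc_of_le h0.le]
    exact (hgi.add continuous_const.integrableOn_Icc).const_mul (2 * (54 + 1))
  have hE0 := eq_zero_of_le_integral_mul hEc (fun t => integral_nonneg (hnn t))
    (fun t => mul_nonneg (by norm_num) (add_nonneg (hg0 t) hM)) hk hgron
  intro t ht x
  have hae := (integral_eq_zero_iff_of_nonneg (hnn t) (hint t)).1 (hE0 t ht)
  have hfun := congrFun ((hxc t).ae_eq_iff_eq volume continuous_zero |>.1 hae) x
  have hi : (1 + x ^ 2)⁻¹ ^ 3 ≠ 0 := by positivity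
  have hw0 : w t x ^ 2 = 0 := (mul_eq_zero.1 hfun).resolve_right hi
  have hw1 : U₁ t x - U₂ t x = 0 := pow_eq_zero_iff (two_ne_zero) |>.1 hw0
  rw [(hu₁ t ht).1, (hu₂ t ht).1] at hw1
  linarith

/-- If `u₁` and `u₂` are strong solutions of `∂ₜ u = (1/2) u ∂ₓ² u`
on a common time interval `[0,T̄)` with the same initial data, then `u₁ = u₂`. -/
theorem uniqueness_of_strong_solutions
    (T : ℝ) (hT : 0 < T) (u₁ u₂ : ℝ → ℝ → ℝ)
    (h₁ : IsStrongSolution T u₁) (h₂ : IsStrongSolution T u₂)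
    (h0 : ∀ x : ℝ, u₁ 0 x = u₂ 0 x) :
    ∀ t ∈ Ico (0:ℝ) T, ∀ x : ℝ, u₁ t x = u₂ t x := by
  intro t ht x
  exact h₁.eqOn_Icc h₂ h0 (by linarith [ht.1] : 0 < (t + T) / 2) (by linarith [ht.2]) t
    ⟨ht.1, by linarith [ht.2]⟩ x
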